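/- arXiv:2510.16385 — 2 statements merged into one kernel-verified Lean document; each statement's English description precedes it below -/
import Mathlib

section
/- Let G=(V,E) be a finite simple undirected graph with preferences as described. If x,y∈ℝ₊^E both satisfy constraints (1) and (2), then x(E) = y(E); that is, every feasible solution of the linear program maximizing x(E) subject to (1), (2) and x≥0 is optimal. -/
/-!
Common setup: a finite simple undirected graph `G = (V, E)` where edges are
elements of `Sym2 V`, together with, for each vertex `v`, a complete and
transitive preference relation `pref v` on `E(v) ∪ {∅}` (the unmatched
option `∅` is encoded as `none : Option (Sym2 V)`), where every incident
edge is strictly preferred to `∅`.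
-/

/-- A roommates instance: a finite simple graph with preferences. -/
structure RSetup (V : Type*) [Fintype V] [DecidableEq V] where
  /-- the edge set -/
  E : Finset (Sym2 V)
  /-- the graph is simple: no loops -/
  not_diag : ∀ e ∈ E, ¬ e.IsDiag
  /-- the preference relation `≿ᵥ` of each vertex, on `E(v) ∪ {∅}` -/
  pref : V → Option (Sym2 V) → Option (Sym2 V) → Prop
  /-- completeness of `≿ᵥ` on `E(v) ∪ {∅}` -/
  pref_total : ∀ v : V, ∀ a b : Option (Sym2 V),
    (∀ e, a = some e → e ∈ E ∧ v ∈ e) → (∀ e, b = some e → e ∈ E ∧ v ∈ e) →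
    pref v a b ∨ pref v b a
  /-- transitivity of `≿ᵥ` on `E(v) ∪ {∅}` -/
  pref_trans : ∀ v : V, ∀ a b c : Option (Sym2 V),
    (∀ e, a = some e → e ∈ E ∧ v ∈ e) → (∀ e, b = some e → e ∈ E ∧ v ∈ e) →
    (∀ e, c = some e → e ∈ E ∧ v ∈ e) →
    pref v a b → pref v b c → pref v a c
  /-- every incident edge is strictly preferred to being unmatched -/
  pref_none : ∀ v : V, ∀ e ∈ E, v ∈ e →
    pref v (some e) none ∧ ¬ pref v none (some e)

namespace RSetup

variable {V : Type*} [Fintype V] [DecidableEq V] (S : RSetup V)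

/-- `a ≻ᵥ b` : strict preference. -/
def SPref (v : V) (a b : Option (Sym2 V)) : Prop :=
  S.pref v a b ∧ ¬ S.pref v b a

/-- `a ∼ᵥ b` : indifference. -/
def IPref (v : V) (a b : Option (Sym2 V)) : Prop :=
  S.pref v a b ∧ S.pref v b a

/-- `F(v)` : the set of edges in `F` incident to `v`. -/
def inc (F : Finset (Sym2 V)) (v : V) : Finset (Sym2 V) :=
  F.filter (fun e => v ∈ e)

/-- a matching in `G` -/
def IsMatching (μ : Finset (Sym2 V)) : Prop :=
  μ ⊆ S.E ∧ ∀ v : V, (inc μ v).card ≤ 1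

/-- `μ(v)` : the edge of `μ` incident to `v` (or `none`). -/
noncomputable def matchOf (μ : Finset (Sym2 V)) (v : V) : Option (Sym2 V) :=
  (inc μ v).toList.head?

/-- `e` blocks the matching `μ`. -/
def Blocks (μ : Finset (Sym2 V)) (e : Sym2 V) : Prop :=
  e ∈ S.E ∧ e ∉ μ ∧ (∀ v ∈ e, S.pref v (some e) (matchOf μ v)) ∧
    (∃ v ∈ e, S.SPref v (some e) (matchOf μ v))

/-- a strongly stable matching in `G` -/
def StronglyStable (μ : Finset (Sym2 V)) : Prop :=
  S.IsMatching μ ∧ ∀ e : Sym2 V, ¬ S.Blocks μ e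

/-- `x(W) = ∑_{e ∈ W} x(e)` -/
def xS (x : Sym2 V → ℝ) (W : Finset (Sym2 V)) : ℝ := ∑ e ∈ W, x e

/-- `x ∈ ℝ₊^E`, encoded as a nonnegative function on `Sym2 V` vanishing
outside `E`. -/
def IsVec (x : Sym2 V → ℝ) : Prop :=
  (∀ e, 0 ≤ x e) ∧ ∀ e ∉ S.E, x e = 0

open Classical in
/-- `E[∼ᵥ e] = {f ∈ E(v) : f ∼ᵥ e}` -/
noncomputable def simSet (v : V) (e : Sym2 V) : Finset (Sym2 V) :=
  (inc S.E v).filter (fun f => S.IPref v (some f) (some e))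

open Classical in
/-- `E[≻ᵥ e] = {f ∈ E(v) : f ≻ᵥ e}` -/
noncomputable def succSet (v : V) (e : Sym2 V) : Finset (Sym2 V) :=
  (inc S.E v).filter (fun f => S.SPref v (some f) (some e))

open Classical in
/-- `E⟨X⟩ = {e ∈ E : e ⊆ X}` -/
noncomputable def esub (X : Finset V) : Finset (Sym2 V) :=
  S.E.filter (fun e => ∀ u ∈ e, u ∈ X)

/-- constraint (1): `x(E(v)) ≤ 1` for every vertex `v` -/
def C1 (x : Sym2 V → ℝ) : Prop := ∀ v : V, xS x (inc S.E v) ≤ 1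

/-- constraint (2): `x(E[∼ᵥ e]) + ∑_{w ∈ e} x(E[≻_w e]) ≥ 1`
for every edge `e ∈ E` and `v ∈ e` -/
def C2 (x : Sym2 V → ℝ) : Prop := ∀ v w : V, s(v, w) ∈ S.E →
  xS x (S.simSet v s(v, w)) +
    (xS x (S.succSet v s(v, w)) + xS x (S.succSet w s(v, w))) ≥ 1

/-- constraint (3): `x(E⟨X⟩) ≤ ⌊|X|/2⌋` for every odd `X ⊆ V` -/
def C3 (x : Sym2 V → ℝ) : Prop := ∀ X : Finset V, Odd X.card →
  xS x (S.esub X) ≤ ((X.card / 2 : ℕ) : ℝ)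

/-- membership in the polytope `P` -/
def memP (x : Sym2 V → ℝ) : Prop := S.IsVec x ∧ S.C1 x ∧ S.C2 x ∧ S.C3 x

/-- the characteristic vector `χ_μ` of a set of edges -/
def chi (μ : Finset (Sym2 V)) : Sym2 V → ℝ := fun e => if e ∈ μ then 1 else 0

open Classical in
/-- `E_x = {e ∈ E : x(e) > 0}` -/
noncomputable def supp (x : Sym2 V → ℝ) : Finset (Sym2 V) :=
  S.E.filter (fun e => 0 < x e)

/-- `V₁` : the set of vertices `v` with `x(E(v)) > 0` for some `x ∈ P` -/
def V1 : Set V := {v : V | ∃ x : Sym2 V → ℝ, S.memP x ∧ 0 < xS x (inc S.E v)}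

open Classical in
/-- `B_x(v)` : the best edges in `E_x(v)` for `v` -/
noncomputable def Bset (x : Sym2 V → ℝ) (v : V) : Finset (Sym2 V) :=
  (inc (S.supp x) v).filter
    (fun e => ∀ f ∈ inc (S.supp x) v, S.pref v (some e) (some f))

open Classical in
/-- `W_x(v)` : the worst edges in `E_x(v)` for `v` -/
noncomputable def Wset (x : Sym2 V → ℝ) (v : V) : Finset (Sym2 V) :=
  (inc (S.supp x) v).filter
    (fun e => ∀ f ∈ inc (S.supp x) v, S.pref v (some f) (some e))

/-- a nonempty `F ⊆ E(v)` is flat if `v` is indifferent among its members -/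
def Flat (v : V) (F : Finset (Sym2 V)) : Prop :=
  F.Nonempty ∧ ∀ e ∈ F, ∀ f ∈ F, S.IPref v (some e) (some f)

open Classical in
/-- `T_x` : edges `e ∈ E⟨V₁⟩` such that, for each `v ∈ e`, either
`e ∈ B_x(v) ∪ W_x(v)` or `B_x(v) ≻ᵥ e ≻ᵥ W_x(v)`. -/
noncomputable def Tset (x : Sym2 V → ℝ) : Finset (Sym2 V) :=
  (S.E.filter (fun e => ∀ u ∈ e, u ∈ S.V1)).filter (fun e => ∀ v ∈ e,
    (e ∈ S.Bset x v ∪ S.Wset x v) ∨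
      ((∀ f ∈ S.Bset x v, S.SPref v (some f) (some e)) ∧
        (∀ f ∈ S.Wset x v, S.SPref v (some e) (some f))))

/-- membership in `P(F) = {x ∈ P : x(e) = 0 for all e ∈ E \ F}` -/
def memPF (F : Finset (Sym2 V)) (x : Sym2 V → ℝ) : Prop :=
  S.memP x ∧ ∀ e ∈ S.E, e ∉ F → x e = 0

open Classical in
/-- `E⁺ = {e ∈ E : e ∈ E_z for some z ∈ P}` -/
noncomputable def Eplus : Finset (Sym2 V) :=
  S.E.filter (fun e => ∃ z : Sym2 V → ℝ, S.memP z ∧ 0 < z e)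

open Classical in
/-- `P'` : given `x ∈ P` and a strongly stable matching `σ`, the set of
vertices `v ∈ V₁` with `W_x(v) ≻ᵥ σ(v)`, or with
`B_x(v) ≻ᵥ W_x(v)` and `W_x(v) ∼ᵥ σ(v)`. -/
def Pset (x : Sym2 V → ℝ) (σ : Finset (Sym2 V)) : Set V :=
  {v : V | v ∈ S.V1 ∧
    ((∀ f ∈ S.Wset x v, S.SPref v (some f) (matchOf σ v)) ∨
      ((∀ f ∈ S.Bset x v, ∀ g ∈ S.Wset x v, S.SPref v (some f) (some g)) ∧
        (∀ f ∈ S.Wset x v, S.IPref v (some f) (matchOf σ v))))}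

/-- `Q'` : given `x ∈ P` and a strongly stable matching `σ`, the set of
vertices `v ∈ V₁` with `σ(v) ≻ᵥ B_x(v)`, or with
`B_x(v) ≻ᵥ W_x(v)` and `B_x(v) ∼ᵥ σ(v)`. -/
def Qset (x : Sym2 V → ℝ) (σ : Finset (Sym2 V)) : Set V :=
  {v : V | v ∈ S.V1 ∧
    ((∀ f ∈ S.Bset x v, S.SPref v (matchOf σ v) (some f)) ∨
      ((∀ f ∈ S.Bset x v, ∀ g ∈ S.Wset x v, S.SPref v (some f) (some g)) ∧
        (∀ f ∈ S.Bset x v, S.IPref v (some f) (matchOf σ v))))}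

/-- `R'` : given `x ∈ P` and a strongly stable matching `σ`, the set of
vertices `v ∈ V₁` such that `E_x(v)` is flat and `E_x(v) ∼ᵥ σ(v)`. -/
def Rset (x : Sym2 V → ℝ) (σ : Finset (Sym2 V)) : Set V :=
  {v : V | v ∈ S.V1 ∧ S.Flat v (inc (S.supp x) v) ∧
    ∀ f ∈ inc (S.supp x) v, S.IPref v (some f) (matchOf σ v)}

end RSetup

namespace RSetup

variable {V : Type*} [Fintype V] [DecidableEq V] (S : RSetup V)

/-- Exchanging a sum over incident vertex-edge pairs. -/
theorem sum_inc_comm (g : V → Sym2 V → ℝ) :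
    ∑ v, ∑ e ∈ inc S.E v, g v e = ∑ e ∈ S.E, ∑ v with v ∈ e, g v e := by
  simp only [inc, Finset.sum_filter]
  exact Finset.sum_comm

theorem filter_mem_mk (a b : V) :
    (Finset.univ.filter fun v => v ∈ s(a, b)) = {a, b} := by
  ext v
  simp

theorem ne_of_mk_mem {a b : V} (h : s(a, b) ∈ S.E) : a ≠ b := by
  simpa using S.not_diag _ h

/-- The fractional handshaking lemma. -/
theorem sum_xS_inc (x : Sym2 V → ℝ) :
    ∑ v, xS x (inc S.E v) = 2 * xS x S.E := by
  simp only [xS]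
  rw [S.sum_inc_comm fun _ e => x e, Finset.mul_sum]
  refine Finset.sum_congr rfl fun e he => ?_
  induction e using Sym2.ind with
  | _ a b =>
    rw [filter_mem_mk, Finset.sum_pair (S.ne_of_mk_mem he), two_mul]

open Classical in
/-- The weight of `f` relative to `e` at `v`: `1` for a tie, `2` if `f` is strictly better. -/
noncomputable def weight (v : V) (e f : Sym2 V) : ℝ :=
  (if S.IPref v (some f) (some e) then 1 else 0) +
    2 * (if S.SPref v (some f) (some e) then 1 else 0)

theorem weight_add_weight_swap {v : V} {e f : Sym2 V}
    (he : e ∈ inc S.E v) (hf : f ∈ inc S.E v) :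
    S.weight v e f + S.weight v f e = 2 := by
  simp only [inc, Finset.mem_filter] at he hf
  have htotal := S.pref_total v (some e) (some f)
    (by rintro _ ⟨⟩; exact he) (by rintro _ ⟨⟩; exact hf)
  unfold weight IPref SPref
  by_cases h₁ : S.pref v (some e) (some f) <;> by_cases h₂ : S.pref v (some f) (some e) <;>
    simp_all [one_add_one_eq_two]

theorem sum_weight_mul (x : Sym2 V → ℝ) (v : V) (e : Sym2 V) :
    ∑ f ∈ inc S.E v, S.weight v e f * x f =
      xS x (S.simSet v e) + 2 * xS x (S.succSet v e) := by
  simp only [weight, xS, simSet, succSet, Finset.sum_filter, add_mul, mul_assoc, ite_mul, one_mul,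
    zero_mul, Finset.sum_add_distrib, Finset.mul_sum]

/-- The inequality obtained by weighting the stability constraints of `x` by `y`. -/
theorem two_mul_xS_le {x y : Sym2 V → ℝ} (hx : S.C2 x) (hy : ∀ e, 0 ≤ y e) :
    2 * xS y S.E ≤
      ∑ v, ∑ e ∈ inc S.E v, ∑ f ∈ inc S.E v, S.weight v e f * (y e * x f) := by
  have hfactor : ∀ v e, ∑ f ∈ inc S.E v, S.weight v e f * (y e * x f) =
      y e * (xS x (S.simSet v e) + 2 * xS x (S.succSet v e)) := fun v e => by
    rw [← sum_weight_mul, Finset.mul_sum]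
    exact Finset.sum_congr rfl fun f _ => by ring
  simp only [hfactor]
  rw [sum_inc_comm, xS, Finset.mul_sum]
  refine Finset.sum_le_sum fun e he => ?_
  induction e using Sym2.ind with
  | _ a b =>
    rw [filter_mem_mk, Finset.sum_pair (S.ne_of_mk_mem he)]
    have hab := hx a b he
    have hba := hx b a (Sym2.eq_swap ▸ he)
    rw [Sym2.eq_swap (a := b) (b := a)] at hba
    rw [← mul_add, mul_comm]
    exact mul_le_mul_of_nonneg_left (by linarith) (hy _)

theorem sum_weight_add_sum_weight (x y : Sym2 V → ℝ) (v : V) :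
    ∑ e ∈ inc S.E v, ∑ f ∈ inc S.E v, S.weight v e f * (y e * x f) +
      ∑ e ∈ inc S.E v, ∑ f ∈ inc S.E v, S.weight v e f * (x e * y f) =
      2 * (xS x (inc S.E v) * xS y (inc S.E v)) := by
  rw [Finset.sum_comm (f := fun e f => S.weight v e f * (x e * y f)), ← Finset.sum_add_distrib,
    mul_comm (xS x _), xS, xS, Finset.sum_mul_sum, Finset.mul_sum]
  refine Finset.sum_congr rfl fun e he => ?_
  rw [← Finset.sum_add_distrib, Finset.mul_sum]
  refine Finset.sum_congr rfl fun f hf => ?_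
  rw [← S.weight_add_weight_swap he hf]
  ring

end RSetup

open RSetup in
/-- any two nonnegative vectors satisfying constraints (1) and
(2) have the same total value `x(E)`; i.e., every feasible solution of the
linear program maximizing `x(E)` subject to (1), (2), `x ≥ 0` is optimal. -/
theorem total_value_eq_of_feasible
    {V : Type*} [Fintype V] [DecidableEq V] (S : RSetup V)
    (x y : Sym2 V → ℝ)
    (hx : S.IsVec x ∧ S.C1 x ∧ S.C2 x) (hy : S.IsVec y ∧ S.C1 y ∧ S.C2 y) :
    xS x S.E = xS y S.E := by
  obtain ⟨⟨hx₀, -⟩, hx₁, hx₂⟩ := hx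
  obtain ⟨⟨hy₀, -⟩, hy₁, hy₂⟩ := hy
  have hsum : xS x S.E + xS y S.E ≤ ∑ v, xS x (inc S.E v) * xS y (inc S.E v) := by
    have hxy := add_le_add (S.two_mul_xS_le hx₂ hy₀) (S.two_mul_xS_le hy₂ hx₀)
    rw [← Finset.sum_add_distrib] at hxy
    simp only [sum_weight_add_sum_weight] at hxy
    rw [← Finset.mul_sum] at hxy
    linarith
  have hle_x : ∑ v, xS x (inc S.E v) * xS y (inc S.E v) ≤ ∑ v, xS x (inc S.E v) :=
    Finset.sum_le_sum fun v _ =>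
      mul_le_of_le_one_right (Finset.sum_nonneg fun e _ => hx₀ e) (hy₁ v)
  have hle_y : ∑ v, xS x (inc S.E v) * xS y (inc S.E v) ≤ ∑ v, xS y (inc S.E v) :=
    Finset.sum_le_sum fun v _ =>
      mul_le_of_le_one_left (Finset.sum_nonneg fun e _ => hy₀ e) (hx₁ v)
  rw [sum_xS_inc] at hle_x hle_y
  linarith
end

section
/- Let G=(V,E) be a finite simple undirected graph with preferences as described, and assume P≠∅. Let x∈P and z∈P(T_x). Then T_z ⊆ T_x. -/
namespace RSetup

theorem mem_inc {V : Type*} [DecidableEq V] {F : Finset (Sym2 V)} {v : V} {e : Sym2 V} :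
    e ∈ inc F v ↔ e ∈ F ∧ v ∈ e := by
  simp [inc]

variable {V : Type*} [Fintype V] [DecidableEq V] (S : RSetup V)

theorem mem_supp {x : Sym2 V → ℝ} {e : Sym2 V} : e ∈ S.supp x ↔ e ∈ S.E ∧ 0 < x e := by
  simp [supp]

theorem mem_succSet {v : V} {e f : Sym2 V} :
    f ∈ S.succSet v e ↔ f ∈ inc S.E v ∧ S.SPref v (some f) (some e) := by
  simp [succSet]

theorem mem_simSet {v : V} {e f : Sym2 V} :
    f ∈ S.simSet v e ↔ f ∈ inc S.E v ∧ S.IPref v (some f) (some e) := by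
  simp [simSet]

theorem mem_Bset {x : Sym2 V → ℝ} {v : V} {e : Sym2 V} :
    e ∈ S.Bset x v ↔ e ∈ inc (S.supp x) v ∧
      ∀ f ∈ inc (S.supp x) v, S.pref v (some e) (some f) := by
  simp only [Bset, Finset.mem_filter]

theorem mem_Wset {x : Sym2 V → ℝ} {v : V} {e : Sym2 V} :
    e ∈ S.Wset x v ↔ e ∈ inc (S.supp x) v ∧
      ∀ f ∈ inc (S.supp x) v, S.pref v (some f) (some e) := by
  simp only [Wset, Finset.mem_filter]

theorem mem_Tset {x : Sym2 V → ℝ} {e : Sym2 V} :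
    e ∈ S.Tset x ↔ (e ∈ S.E ∧ ∀ u ∈ e, u ∈ S.V1) ∧ ∀ v ∈ e,
      (e ∈ S.Bset x v ∪ S.Wset x v) ∨
        ((∀ f ∈ S.Bset x v, S.SPref v (some f) (some e)) ∧
          (∀ f ∈ S.Wset x v, S.SPref v (some e) (some f))) := by
  simp only [Tset, Finset.mem_filter]

theorem mem_inc_supp_of_mem_union {x : Sym2 V → ℝ} {v : V} {e : Sym2 V}
    (h : e ∈ S.Bset x v ∪ S.Wset x v) : e ∈ inc (S.supp x) v :=
  (Finset.mem_union.1 h).elim (fun h => (S.mem_Bset.1 h).1) (fun h => (S.mem_Wset.1 h).1)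

theorem pref_total_edges {v : V} {e f : Sym2 V} (he : e ∈ S.E) (hve : v ∈ e)
    (hf : f ∈ S.E) (hvf : v ∈ f) :
    S.pref v (some e) (some f) ∨ S.pref v (some f) (some e) :=
  S.pref_total v _ _ (by rintro _ ⟨⟩; exact ⟨he, hve⟩) (by rintro _ ⟨⟩; exact ⟨hf, hvf⟩)

theorem pref_trans_edges {v : V} {e f g : Sym2 V} (he : e ∈ inc S.E v) (hf : f ∈ inc S.E v)
    (hg : g ∈ inc S.E v) (hef : S.pref v (some e) (some f))
    (hfg : S.pref v (some f) (some g)) : S.pref v (some e) (some g) :=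
  S.pref_trans v _ _ _ (by rintro _ ⟨⟩; exact mem_inc.1 he)
    (by rintro _ ⟨⟩; exact mem_inc.1 hf)
    (by rintro _ ⟨⟩; exact mem_inc.1 hg) hef hfg

theorem inc_supp_subset (x : Sym2 V → ℝ) (v : V) : inc (S.supp x) v ⊆ inc S.E v :=
  Finset.filter_subset_filter _ (Finset.filter_subset _ _)

/-- A nonempty finite set on which a relation is total and transitive has a greatest element. -/
theorem exists_greatest_of_total_trans {α : Type*} (r : α → α → Prop) {s t : Finset α}
    (hs : s.Nonempty) (hst : s ⊆ t) (htot : ∀ a ∈ t, ∀ b ∈ t, r a b ∨ r b a)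
    (htrans : ∀ a ∈ t, ∀ b ∈ t, ∀ c ∈ t, r a b → r b c → r a c) :
    ∃ m ∈ s, ∀ b ∈ s, r m b := by
  induction hs using Finset.Nonempty.cons_induction with
  | singleton a =>
    have ha : a ∈ t := hst (Finset.mem_singleton_self a)
    refine ⟨a, Finset.mem_singleton_self a, fun b hb => ?_⟩
    rw [Finset.mem_singleton.1 hb]
    exact (htot a ha a ha).elim id id
  | cons a s has hs ih =>
    rw [Finset.cons_subset] at hst
    obtain ⟨m, hm, hmax⟩ := ih hst.2
    rcases htot a hst.1 m (hst.2 hm) with h | h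
    · refine ⟨a, Finset.mem_cons_self a s, fun b hb => ?_⟩
      rcases Finset.mem_cons.1 hb with rfl | hb
      · exact (htot _ hst.1 _ hst.1).elim id id
      · exact htrans a hst.1 m (hst.2 hm) b (hst.2 hb) h (hmax b hb)
    · refine ⟨m, Finset.mem_cons_of_mem hm, fun b hb => ?_⟩
      rcases Finset.mem_cons.1 hb with rfl | hb
      · exact h
      · exact hmax b hb

theorem Bset_nonempty {x : Sym2 V → ℝ} {v : V} (h : (inc (S.supp x) v).Nonempty) :
    (S.Bset x v).Nonempty := by
  obtain ⟨m, hm, hmax⟩ := exists_greatest_of_total_trans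
    (fun e f => S.pref v (some e) (some f)) h (S.inc_supp_subset x v)
    (fun a ha b hb => S.pref_total_edges (mem_inc.1 ha).1 (mem_inc.1 ha).2
      (mem_inc.1 hb).1 (mem_inc.1 hb).2)
    (fun a ha b hb c hc => S.pref_trans_edges ha hb hc)
  exact ⟨m, S.mem_Bset.2 ⟨hm, hmax⟩⟩

theorem Wset_nonempty {x : Sym2 V → ℝ} {v : V} (h : (inc (S.supp x) v).Nonempty) :
    (S.Wset x v).Nonempty := by
  obtain ⟨m, hm, hmax⟩ := exists_greatest_of_total_trans
    (fun e f => S.pref v (some f) (some e)) h (S.inc_supp_subset x v)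
    (fun a ha b hb => S.pref_total_edges (mem_inc.1 hb).1 (mem_inc.1 hb).2
      (mem_inc.1 ha).1 (mem_inc.1 ha).2)
    (fun a ha b hb c hc hab hbc => S.pref_trans_edges hc hb ha hbc hab)
  exact ⟨m, S.mem_Wset.2 ⟨hm, hmax⟩⟩

theorem xS_eq_sum_neighbors (x : Sym2 V → ℝ) (v : V) (F : Finset (Sym2 V))
    (hF : ∀ e ∈ F, v ∈ e) :
    xS x F = ∑ w, if s(v, w) ∈ F then x s(v, w) else 0 := by
  rw [xS, ← Finset.sum_filter]
  symm
  refine Finset.sum_bij (fun w _ => s(v, w)) ?_ ?_ ?_ ?_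
  · intro w hw
    exact (Finset.mem_filter.1 hw).2
  · intro a _ b _ h
    exact Sym2.congr_right.1 h
  · intro e he
    obtain ⟨w, rfl⟩ := Sym2.mem_iff_exists.1 (hF e he)
    exact ⟨w, by simpa using he, rfl⟩
  · intro w _
    rfl

theorem xS_inc_eq_sum {x : Sym2 V → ℝ} (hx : S.IsVec x) (v : V) :
    xS x (inc S.E v) = ∑ w, x s(v, w) := by
  rw [xS_eq_sum_neighbors x v (inc S.E v) (fun e he => (mem_inc.1 he).2)]
  refine Finset.sum_congr rfl fun w _ => ?_
  by_cases h : s(v, w) ∈ S.E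
  · simp [mem_inc, h]
  · simp [mem_inc, h, hx.2 _ h]

open Classical in
/-- Weight of `f` against `e` at `v`: `1` if `f ≻ᵥ e`, `1 / 2` if `f ∼ᵥ e`, and `0` otherwise. -/
noncomputable def prefWeight (v : V) (e f : Sym2 V) : ℝ :=
  (if S.SPref v (some f) (some e) then 1 else 0) +
    (if S.IPref v (some f) (some e) then 1 / 2 else 0)

theorem prefWeight_add_swap {v : V} {e f : Sym2 V} (he : e ∈ S.E) (hve : v ∈ e)
    (hf : f ∈ S.E) (hvf : v ∈ f) : S.prefWeight v e f + S.prefWeight v f e = 1 := by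
  have h := S.pref_total_edges he hve hf hvf
  unfold prefWeight SPref IPref
  by_cases h₁ : S.pref v (some e) (some f) <;> by_cases h₂ : S.pref v (some f) (some e)
  · simp [h₁, h₂]; norm_num
  · simp [h₁, h₂]
  · simp [h₁, h₂]
  · exact absurd h (by tauto)

theorem sum_prefWeight {x : Sym2 V → ℝ} (hx : S.IsVec x) (v : V) (e : Sym2 V) :
    ∑ u, x s(v, u) * S.prefWeight v e s(v, u) =
      xS x (S.succSet v e) + xS x (S.simSet v e) / 2 := by
  rw [xS_eq_sum_neighbors x v (S.succSet v e), xS_eq_sum_neighbors x v (S.simSet v e),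
    Finset.sum_div, ← Finset.sum_add_distrib]
  · refine Finset.sum_congr rfl fun u _ => ?_
    by_cases h : s(v, u) ∈ S.E
    · have hinc : s(v, u) ∈ inc S.E v := mem_inc.2 ⟨h, Sym2.mem_mk_left v u⟩
      have hsucc := S.mem_succSet (v := v) (e := e) (f := s(v, u))
      have hsim := S.mem_simSet (v := v) (e := e) (f := s(v, u))
      unfold prefWeight
      split_ifs <;> first | (exfalso; tauto) | ring
    · simp [hx.2 _ h]
  · intro f hf
    exact (mem_inc.1 (S.mem_simSet.1 hf).1).2
  · intro f hf
    exact (mem_inc.1 (S.mem_succSet.1 hf).1).2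

theorem one_le_sum_prefWeight {x : Sym2 V → ℝ} (hx : S.IsVec x) (h2 : S.C2 x) {v w : V}
    (hvw : s(v, w) ∈ S.E) :
    1 ≤ ∑ u, x s(v, u) * S.prefWeight v s(v, w) s(v, u) +
      ∑ u, x s(w, u) * S.prefWeight w s(v, w) s(w, u) := by
  rw [S.sum_prefWeight hx, S.sum_prefWeight hx]
  have h₁ := h2 v w hvw
  have h₂ := h2 w v (Sym2.eq_swap (a := v) (b := w) ▸ hvw)
  rw [Sym2.eq_swap (a := w) (b := v)] at h₂
  linarith

/-- The total preference weight of `x` against `y`. -/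
noncomputable def totalPrefWeight (x y : Sym2 V → ℝ) : ℝ :=
  ∑ v, ∑ w, y s(v, w) * ∑ u, x s(v, u) * S.prefWeight v s(v, w) s(v, u)

theorem sum_le_two_mul_totalPrefWeight {x y : Sym2 V → ℝ} (hx : S.IsVec x) (h2 : S.C2 x)
    (hy : S.IsVec y) :
    ∑ v, ∑ w, y s(v, w) ≤ 2 * S.totalPrefWeight x y := by
  have hswap : S.totalPrefWeight x y =
      ∑ v, ∑ w, y s(v, w) * ∑ u, x s(w, u) * S.prefWeight w s(v, w) s(w, u) := by
    rw [totalPrefWeight, Finset.sum_comm]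
    refine Finset.sum_congr rfl fun v _ => Finset.sum_congr rfl fun w _ => ?_
    rw [Sym2.eq_swap (a := w) (b := v)]
  rw [two_mul]
  nth_rewrite 2 [hswap]
  rw [totalPrefWeight, ← Finset.sum_add_distrib]
  refine Finset.sum_le_sum fun v _ => ?_
  rw [← Finset.sum_add_distrib]
  refine Finset.sum_le_sum fun w _ => ?_
  rw [← mul_add]
  by_cases h : s(v, w) ∈ S.E
  · exact le_mul_of_one_le_right (hy.1 _) (S.one_le_sum_prefWeight hx h2 h)
  · simp [hy.2 _ h]

theorem totalPrefWeight_add_swap {x y : Sym2 V → ℝ} (hx : S.IsVec x) (hy : S.IsVec y) :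
    S.totalPrefWeight x y + S.totalPrefWeight y x =
      ∑ v, (∑ w, x s(v, w)) * ∑ w, y s(v, w) := by
  rw [totalPrefWeight, totalPrefWeight, ← Finset.sum_add_distrib]
  refine Finset.sum_congr rfl fun v _ => ?_
  rw [mul_comm, Finset.sum_mul_sum]
  simp only [Finset.mul_sum]
  nth_rewrite 2 [Finset.sum_comm]
  rw [← Finset.sum_add_distrib]
  refine Finset.sum_congr rfl fun w _ => ?_
  rw [← Finset.sum_add_distrib]
  refine Finset.sum_congr rfl fun u _ => ?_
  by_cases hw : s(v, w) ∈ S.E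
  · by_cases hu : s(v, u) ∈ S.E
    · have h := S.prefWeight_add_swap hw (Sym2.mem_mk_left v w) hu (Sym2.mem_mk_left v u)
      linear_combination y s(v, w) * x s(v, u) * h
    · simp [hx.2 _ hu]
  · simp [hy.2 _ hw]

/-- All points of `P` give the same total weight to the edges at each vertex. -/
theorem xS_inc_eq_of_memP {x y : Sym2 V → ℝ} (hx : S.memP x) (hy : S.memP y) (v : V) :
    xS x (inc S.E v) = xS y (inc S.E v) := by
  obtain ⟨hxv, hx1, hx2, -⟩ := hx
  obtain ⟨hyv, hy1, hy2, -⟩ := hy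
  have hle := S.sum_le_two_mul_totalPrefWeight hxv hx2 hyv
  have hle' := S.sum_le_two_mul_totalPrefWeight hyv hy2 hxv
  have hsum := S.totalPrefWeight_add_swap hxv hyv
  simp only [← S.xS_inc_eq_sum hxv, ← S.xS_inc_eq_sum hyv] at hle hle' hsum
  set a : V → ℝ := fun v => xS x (inc S.E v)
  set b : V → ℝ := fun v => xS y (inc S.E v)
  have ha0 : ∀ u, 0 ≤ a u := fun u => Finset.sum_nonneg fun e _ => hxv.1 e
  have hb0 : ∀ u, 0 ≤ b u := fun u => Finset.sum_nonneg fun e _ => hyv.1 e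
  have hgap : ∀ u, 0 ≤ a u * (1 - b u) + b u * (1 - a u) := fun u =>
    add_nonneg (mul_nonneg (ha0 u) (sub_nonneg.2 (hy1 u)))
      (mul_nonneg (hb0 u) (sub_nonneg.2 (hx1 u)))
  have htotal : ∑ u, (a u * (1 - b u) + b u * (1 - a u)) ≤ 0 := by
    have : ∑ u, (a u * (1 - b u) + b u * (1 - a u)) =
        ∑ u, a u + ∑ u, b u - 2 * ∑ u, a u * b u := by
      rw [Finset.mul_sum, ← Finset.sum_add_distrib, ← Finset.sum_sub_distrib]
      exact Finset.sum_congr rfl fun u _ => by ring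
    linarith
  have hzero := (Finset.sum_eq_zero_iff_of_nonneg fun u _ => hgap u).1
    (le_antisymm htotal (Finset.sum_nonneg fun u _ => hgap u)) v (Finset.mem_univ v)
  have h₁ := mul_nonneg (ha0 v) (sub_nonneg.2 (hy1 v))
  have h₂ := mul_nonneg (hb0 v) (sub_nonneg.2 (hx1 v))
  change a v = b v
  change 0 ≤ a v * (1 - b v) at h₁
  change 0 ≤ b v * (1 - a v) at h₂
  linarith

theorem inc_supp_nonempty {z : Sym2 V → ℝ} (hz : S.memP z) {v : V} (hv : v ∈ S.V1) :
    (inc (S.supp z) v).Nonempty := by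
  obtain ⟨y, hy, hpos⟩ := hv
  rw [S.xS_inc_eq_of_memP hy hz v] at hpos
  obtain ⟨e, he, hze⟩ := Finset.exists_lt_of_sum_lt
    (s := inc S.E v) (f := fun _ => (0 : ℝ)) (g := z) (by simpa [xS] using hpos)
  obtain ⟨heE, hve⟩ := mem_inc.1 he
  exact ⟨e, mem_inc.2 ⟨S.mem_supp.2 ⟨heE, hze⟩, hve⟩⟩

theorem supp_subset_of_memPF {F : Finset (Sym2 V)} {z : Sym2 V → ℝ} (hz : S.memPF F z) :
    S.supp z ⊆ F := by
  intro e he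
  obtain ⟨heE, hpos⟩ := S.mem_supp.1 he
  by_contra h
  exact hpos.ne' (hz.2 e heE h)

theorem pref_of_mem_Bset_of_mem_Tset {x : Sym2 V → ℝ} {v : V} {e f : Sym2 V}
    (he : e ∈ S.Tset x) (hve : v ∈ e) (hf : f ∈ S.Bset x v) : S.pref v (some f) (some e) := by
  rcases (S.mem_Tset.1 he).2 v hve with h | h
  · exact (S.mem_Bset.1 hf).2 e (S.mem_inc_supp_of_mem_union h)
  · exact (h.1 f hf).1

theorem pref_of_mem_Wset_of_mem_Tset {x : Sym2 V → ℝ} {v : V} {e f : Sym2 V}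
    (he : e ∈ S.Tset x) (hve : v ∈ e) (hf : f ∈ S.Wset x v) : S.pref v (some e) (some f) := by
  rcases (S.mem_Tset.1 he).2 v hve with h | h
  · exact (S.mem_Wset.1 hf).2 e (S.mem_inc_supp_of_mem_union h)
  · exact (h.2 f hf).1

end RSetup

open RSetup in
/-- if `x ∈ P` and `z ∈ P(T_x)`, then `T_z ⊆ T_x`. -/
theorem Tset_subset
    {V : Type*} [Fintype V] [DecidableEq V] (S : RSetup V)
    (hP : ∃ y : Sym2 V → ℝ, S.memP y)
    (x z : Sym2 V → ℝ) (hx : S.memP x) (hz : S.memPF (S.Tset x) z) :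
    S.Tset z ⊆ S.Tset x := by
  intro e he
  obtain ⟨⟨heE, hV1⟩, hcond⟩ := S.mem_Tset.1 he
  refine S.mem_Tset.2 ⟨⟨heE, hV1⟩, fun v hv => ?_⟩
  have hsub := S.supp_subset_of_memPF hz
  have hevE : e ∈ inc S.E v := mem_inc.2 ⟨heE, hv⟩
  rcases hcond v hv with h | ⟨hB, hW⟩
  · have hes : e ∈ inc (S.supp z) v :=
      S.mem_inc_supp_of_mem_union h
    exact (S.mem_Tset.1 (hsub (mem_inc.1 hes).1)).2 v hv
  · have hne := S.inc_supp_nonempty hz.1 (hV1 v hv)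
    right
    constructor
    · intro f hf
      obtain ⟨b, hb⟩ := S.Bset_nonempty hne
      have hbs := (S.mem_Bset.1 hb).1
      obtain ⟨hbz, hvb⟩ := mem_inc.1 hbs
      have hbE := S.inc_supp_subset z v hbs
      have hfE := S.inc_supp_subset x v (S.mem_Bset.1 hf).1
      have hfb := S.pref_of_mem_Bset_of_mem_Tset (hsub hbz) hvb hf
      exact ⟨S.pref_trans_edges hfE hbE hevE hfb (hB b hb).1,
        fun h => (hB b hb).2 (S.pref_trans_edges hevE hfE hbE h hfb)⟩
    · intro f hf
      obtain ⟨b, hb⟩ := S.Wset_nonempty hne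
      have hbs := (S.mem_Wset.1 hb).1
      obtain ⟨hbz, hvb⟩ := mem_inc.1 hbs
      have hbE := S.inc_supp_subset z v hbs
      have hfE := S.inc_supp_subset x v (S.mem_Wset.1 hf).1
      have hbf := S.pref_of_mem_Wset_of_mem_Tset (hsub hbz) hvb hf
      exact ⟨S.pref_trans_edges hevE hbE hfE (hW b hb).1 hbf,
        fun h => (hW b hb).2 (S.pref_trans_edges hbE hfE hevE hbf h)⟩
end
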